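/- arXiv:0802.0264 — 2 statements merged into one kernel-verified Lean document; each statement's English description precedes it below -/
import Mathlib

section
/- For all ξ ∈ ℝ: Y(1/2, ξ) = F_{1/2}[e_{1/2}^{-x²}](ξ) = (16√2/15)·(1 − (5/16)·ξ²), and Y(2/3, ξ) = F_{2/3}[e_{2/3}^{-x²}](ξ) = (32√3/35)·(1 − (7/24)·ξ²). Consequently, on the interval where 1 − (5/16)ξ² ≥ 0 (respectively 1 − (7/24)ξ² ≥ 0) these functions coincide with (16√2/15)·e_0^{-(5/16)ξ²} (respectively (32√3/35)·e_0^{-(7/24)ξ²}), i.e. with elements of 𝒢_0. -/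
open MeasureTheory Complex Real Set Filter

noncomputable section

/-- The complex `q`-exponential: principal branch of `(1+(1-q)z)^{1/(1-q)}`,
set to `0` when `1+(1-q)z` is a nonpositive real; `exp z` for `q = 1`. -/
def qExp (q : ℝ) (z : ℂ) : ℂ :=
  if q = 1 then Complex.exp z
  else if (1 + (1 - q) * z).im = 0 ∧ (1 + (1 - q) * z).re ≤ 0 then 0
  else (1 + (1 - q) * z) ^ ((1 : ℂ) / (1 - q))

/-- The real `q`-exponential: `(1+(1-q)z)^{1/(1-q)}` when `1+(1-q)z > 0`,
`0` when `1+(1-q)z ≤ 0`; `exp z` for `q = 1`. -/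
def qExpR (q z : ℝ) : ℝ :=
  if q = 1 then Real.exp z
  else if 1 + (1 - q) * z ≤ 0 then 0
  else (1 + (1 - q) * z) ^ ((1 : ℝ) / (1 - q))

/-- The `q`-Fourier transform of a nonnegative function `f` on `ℝ`:
`F_q[f](ξ) = ∫_{{x : f x > 0}} f(x) · e_q^{i x ξ f(x)^{q-1}} dx`. -/
def qFourier (q : ℝ) (f : ℝ → ℝ) (ξ : ℝ) : ℂ :=
  ∫ x in {x : ℝ | 0 < f x},
    (f x : ℂ) * qExp q (Complex.I * (x : ℂ) * (ξ : ℂ) * ((f x ^ (q - 1) : ℝ) : ℂ))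

/-- `Y(q,ξ) = ∫_{-K}^{K} e_q^{-x² + i x ξ} dx`, with `K = (1-q)^{-1/2}` if `q < 1`
and the integral over all of `ℝ` if `q ≥ 1`. -/
def Yfun (q ξ : ℝ) : ℂ :=
  if q < 1 then
    ∫ x in Set.Ioo (-((1 - q) ^ (-(1 : ℝ) / 2))) ((1 - q) ^ (-(1 : ℝ) / 2)),
      qExp q (-(x : ℂ) ^ 2 + Complex.I * (x : ℂ) * (ξ : ℂ))
  else ∫ x : ℝ, qExp q (-(x : ℂ) ^ 2 + Complex.I * (x : ℂ) * (ξ : ℂ))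

/-- The support of the real `q`-Gaussian for `q < 1` is the interval `(-K, K)`. -/
theorem setOf_qExpR_neg_sq_pos {q : ℝ} (hq : q < 1) :
    {x : ℝ | 0 < qExpR q (-x ^ 2)} =
      Set.Ioo (-((1 - q) ^ (-(1 : ℝ) / 2))) ((1 - q) ^ (-(1 : ℝ) / 2)) := by
  have hc : 0 < 1 - q := by linarith
  have hK : 0 < (1 - q) ^ (-(1 : ℝ) / 2) := Real.rpow_pos_of_pos hc _
  have hK2 : (1 - q) * ((1 - q) ^ (-(1 : ℝ) / 2)) ^ 2 = 1 := by
    rw [← Real.rpow_natCast, ← Real.rpow_mul hc.le]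
    norm_num [Real.rpow_neg_one, hc.ne']
  have hpos (x : ℝ) : 0 < qExpR q (-x ^ 2) ↔ 0 < 1 + (1 - q) * (-x ^ 2) := by
    unfold qExpR
    rw [if_neg hq.ne]
    split_ifs with h
    · simpa using h
    · exact iff_of_true (Real.rpow_pos_of_pos (not_le.mp h) _) (not_le.mp h)
  ext x
  rw [Set.mem_ofPred_eq, hpos, Set.mem_Ioo, ← abs_lt, ← abs_of_pos hK, ← sq_lt_sq,
    ← mul_lt_mul_iff_right₀ (b := x ^ 2) hc, hK2]
  constructor <;> intro h <;> linarith

theorem one_sub_mul_sq_pos_of_mem_Ioo {q x : ℝ} (hq : q < 1)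
    (hx : x ∈ Set.Ioo (-((1 - q) ^ (-(1 : ℝ) / 2))) ((1 - q) ^ (-(1 : ℝ) / 2))) :
    0 < 1 - (1 - q) * x ^ 2 := by
  rw [← setOf_qExpR_neg_sq_pos hq, Set.mem_ofPred_eq, qExpR, if_neg hq.ne] at hx
  split_ifs at hx with h
  · exact absurd hx (lt_irrefl 0)
  · linarith

theorem qExp_of_re_pos {q : ℝ} {z : ℂ} (hq : q ≠ 1) (hz : 0 < (1 + (1 - q) * z).re) :
    qExp q z = (1 + (1 - q) * z) ^ ((1 : ℂ) / (1 - q)) := by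
  rw [qExp, if_neg hq, if_neg fun h => hz.not_ge h.2]

theorem qExpR_of_pos {q z : ℝ} (hq : q ≠ 1) (hz : 0 < 1 + (1 - q) * z) :
    qExpR q z = (1 + (1 - q) * z) ^ ((1 : ℝ) / (1 - q)) := by
  rw [qExpR, if_neg hq, if_neg hz.not_ge]

/-- For `q < 1`, `Y(q, ·)` is the `q`-Fourier transform of the `q`-Gaussian. -/
theorem Yfun_eq_qFourier {q : ℝ} (hq : q < 1) (ξ : ℝ) :
    Yfun q ξ = qFourier q (fun x => qExpR q (-x ^ 2)) ξ := by
  rw [Yfun, if_pos hq, qFourier, setOf_qExpR_neg_sq_pos hq]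
  refine setIntegral_congr_fun measurableSet_Ioo fun x hx => ?_
  have hc : 1 - q ≠ 0 := by linarith
  have ha := one_sub_mul_sq_pos_of_mem_Ioo hq hx
  set a : ℝ := 1 - (1 - q) * x ^ 2 with ha_def
  have ha' : 1 + (1 - q) * (-x ^ 2) = a := by rw [ha_def]; ring
  have hac : (a : ℂ) ≠ 0 := by exact_mod_cast ha.ne'
  have hf : qExpR q (-x ^ 2) = a ^ ((1 : ℝ) / (1 - q)) := by
    rw [qExpR_of_pos hq.ne (by rw [ha']; exact ha), ha']
  have hinv : (a ^ ((1 : ℝ) / (1 - q))) ^ (q - 1) = a⁻¹ := by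
    rw [← Real.rpow_mul ha.le, ← Real.rpow_neg_one]
    congr 1
    field_simp
    ring
  have hfactor : 1 + (1 - q) * (-(x : ℂ) ^ 2 + I * x * ξ) =
      a * (1 + (1 - q) * (I * x * ξ * (a⁻¹ : ℝ))) := by
    push_cast
    field_simp
    rw [ha_def]
    push_cast
    ring
  have hre : (1 + (1 - q) * (I * x * ξ * (a⁻¹ : ℝ)) : ℂ).re = 1 := by
    simp
  have hre' : (1 + (1 - q) * (-(x : ℂ) ^ 2 + I * x * ξ)).re = a := by
    rw [hfactor, Complex.re_ofReal_mul, hre, mul_one]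
  rw [hf, hinv, qExp_of_re_pos hq.ne (by rw [hre']; exact ha),
    qExp_of_re_pos hq.ne (by rw [hre]; exact one_pos), hfactor,
    Complex.ofReal_cpow ha.le]
  push_cast
  have hw : (1 + (1 - q) * (I * x * ξ * (a⁻¹ : ℝ)) : ℂ) ≠ 0 := fun h => by
    rw [h] at hre
    exact zero_ne_one hre
  push_cast at hw
  rw [Complex.cpow_def_of_ne_zero (mul_ne_zero hac hw), Complex.cpow_def_of_ne_zero hac,
    Complex.cpow_def_of_ne_zero hw, Complex.log_ofReal_mul ha hw, Complex.ofReal_log ha.le,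
    add_mul, Complex.exp_add]

/-- When `1 / (1 - q)` is a natural number `n`, `Y(q, ·)` is the integral of a polynomial. -/
theorem Yfun_eq_intervalIntegral {q : ℝ} {n : ℕ} (hq : q < 1) (hn : (n : ℝ) * (1 - q) = 1)
    (ξ : ℝ) :
    Yfun q ξ = ∫ x in -√n..√n, (1 + (1 - q) * (-(x : ℂ) ^ 2 + I * x * ξ)) ^ n := by
  have hc : 0 < 1 - q := by linarith
  have hc' : (1 - q : ℂ) ≠ 0 := by exact_mod_cast hc.ne'
  have hn' : (1 : ℂ) / (1 - q) = n := by
    rw [div_eq_iff hc']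
    exact_mod_cast hn.symm
  have hK : (1 - q) ^ (-(1 : ℝ) / 2) = √n := by
    rw [eq_div_of_mul_eq hc.ne' hn, Real.sqrt_eq_rpow, one_div, Real.inv_rpow hc.le,
      ← Real.rpow_neg hc.le]
    norm_num
  rw [intervalIntegral.integral_of_le (by linarith [Real.sqrt_nonneg n]),
    integral_Ioc_eq_integral_Ioo, Yfun, if_pos hq, ← hK]
  refine setIntegral_congr_fun measurableSet_Ioo fun x hx => ?_
  have ha := one_sub_mul_sq_pos_of_mem_Ioo hq hx
  have hre : (1 + (1 - q) * (-(x : ℂ) ^ 2 + I * x * ξ)).re = 1 - (1 - q) * x ^ 2 := by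
    simp [pow_two]
    ring
  rw [qExp_of_re_pos hq.ne (by rw [hre]; exact ha), hn', Complex.cpow_natCast]

theorem Yfun_one_half (ξ : ℝ) :
    Yfun (1 / 2) ξ = (((16 * Real.sqrt 2 / 15) * (1 - (5 / 16) * ξ ^ 2) : ℝ) : ℂ) := by
  have hs : ((√2 : ℝ) : ℂ) ^ 2 = 2 := by exact_mod_cast Real.sq_sqrt zero_le_two
  rw [Yfun_eq_intervalIntegral (n := 2) (by norm_num) (by norm_num), Nat.cast_ofNat]
  have hderiv (x : ℝ) : HasDerivAt
      (fun y : ℝ => (y : ℂ) - y ^ 3 / 3 + y ^ 5 / 20 - ξ ^ 2 * y ^ 3 / 12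
        + I * ξ * (y ^ 2 / 2 - y ^ 4 / 8))
      ((1 + (1 - (1 / 2 : ℝ)) * (-(x : ℂ) ^ 2 + I * x * ξ)) ^ 2) x := by
    have hx : HasDerivAt (fun y : ℝ => (y : ℂ)) 1 x := Complex.ofRealCLM.hasDerivAt
    refine (((((hx.sub ((hx.pow 3).div_const 3)).add ((hx.pow 5).div_const 20)).sub
      (((hx.pow 3).const_mul ((ξ : ℂ) ^ 2)).div_const 12)).add
      ((((hx.pow 2).div_const 2).sub ((hx.pow 4).div_const 8)).const_mul (I * ξ)))).congr_deriv ?_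
    push_cast
    linear_combination (-(x : ℂ) ^ 2 * ξ ^ 2 / 4) * I_sq
  rw [intervalIntegral.integral_eq_sub_of_hasDerivAt (fun x _ => hderiv x)
    (Continuous.intervalIntegrable (by fun_prop) _ _)]
  push_cast
  linear_combination
    (-(2 / 3 : ℂ) * √2 + (√2 : ℝ) * ((√2 : ℝ) ^ 2 + 2) / 10 - (√2 : ℝ) * ξ ^ 2 / 6) * hs

theorem Yfun_two_thirds (ξ : ℝ) :
    Yfun (2 / 3) ξ = (((32 * Real.sqrt 3 / 35) * (1 - (7 / 24) * ξ ^ 2) : ℝ) : ℂ) := by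
  have hs : ((√3 : ℝ) : ℂ) ^ 2 = 3 := by exact_mod_cast Real.sq_sqrt zero_le_three
  rw [Yfun_eq_intervalIntegral (n := 3) (by norm_num) (by norm_num), Nat.cast_ofNat]
  have hderiv (x : ℝ) : HasDerivAt
      (fun y : ℝ => (y : ℂ) - y ^ 3 / 3 + y ^ 5 / 15 - y ^ 7 / 189
        - ξ ^ 2 * (y ^ 3 / 9 - y ^ 5 / 45)
        + I * (ξ * (y ^ 2 / 2 - y ^ 4 / 6 + y ^ 6 / 54) - ξ ^ 3 * y ^ 4 / 108))
      ((1 + (1 - (2 / 3 : ℝ)) * (-(x : ℂ) ^ 2 + I * x * ξ)) ^ 3) x := by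
    have hx : HasDerivAt (fun y : ℝ => (y : ℂ)) 1 x := Complex.ofRealCLM.hasDerivAt
    refine (((((hx.sub ((hx.pow 3).div_const 3)).add ((hx.pow 5).div_const 15)).sub
      ((hx.pow 7).div_const 189)).sub
      ((((hx.pow 3).div_const 9).sub ((hx.pow 5).div_const 45)).const_mul ((ξ : ℂ) ^ 2))).add
      ((((((hx.pow 2).div_const 2).sub ((hx.pow 4).div_const 6)).add
        ((hx.pow 6).div_const 54)).const_mul (ξ : ℂ)).sub
        (((hx.pow 4).const_mul ((ξ : ℂ) ^ 3)).div_const 108) |>.const_mul I)).congr_deriv ?_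
    push_cast
    linear_combination
      (-(1 - (x : ℂ) ^ 2 / 3) * x ^ 2 * ξ ^ 2 / 3 - I * (x : ℂ) ^ 3 * ξ ^ 3 / 27) * I_sq
  rw [intervalIntegral.integral_eq_sub_of_hasDerivAt (fun x _ => hderiv x)
    (Continuous.intervalIntegrable (by fun_prop) _ _)]
  have hs3 : ((√3 : ℝ) : ℂ) ^ 3 = 3 * (√3 : ℝ) := by linear_combination (√3 : ℝ) * hs
  have hs5 : ((√3 : ℝ) : ℂ) ^ 5 = 9 * (√3 : ℝ) := by
    linear_combination ((√3 : ℝ) : ℂ) ^ 2 * hs3 + 3 * hs3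
  have hs7 : ((√3 : ℝ) : ℂ) ^ 7 = 27 * (√3 : ℝ) := by
    linear_combination ((√3 : ℝ) : ℂ) ^ 2 * hs5 + 9 * hs3
  push_cast
  linear_combination
    (-2 / 3 - 2 * (ξ : ℂ) ^ 2 / 9) * hs3 + (2 / 15 + 2 * (ξ : ℂ) ^ 2 / 45) * hs5 - 2 / 189 * hs7

theorem qExpR_zero_of_nonneg {z : ℝ} (hz : 0 ≤ 1 + z) : qExpR 0 z = 1 + z := by
  rw [qExpR, if_neg zero_ne_one]
  split_ifs with h
  · linarith
  · norm_num

/-- explicit formulas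
`Y(1/2,ξ) = F_{1/2}[e_{1/2}^{-x²}](ξ) = (16√2/15)(1 - (5/16)ξ²)` and
`Y(2/3,ξ) = F_{2/3}[e_{2/3}^{-x²}](ξ) = (32√3/35)(1 - (7/24)ξ²)`; on the intervals
where `1 - (5/16)ξ² ≥ 0` resp. `1 - (7/24)ξ² ≥ 0` these coincide with the elements
`(16√2/15) e_0^{-(5/16)ξ²}` resp. `(32√3/35) e_0^{-(7/24)ξ²}` of `𝒢₀`. -/
theorem Yfun_half_and_two_thirds :
    (∀ ξ : ℝ, Yfun (1 / 2) ξ = qFourier (1 / 2) (fun x => qExpR (1 / 2) (-x ^ 2)) ξ) ∧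
    (∀ ξ : ℝ, Yfun (2 / 3) ξ = qFourier (2 / 3) (fun x => qExpR (2 / 3) (-x ^ 2)) ξ) ∧
    (∀ ξ : ℝ, Yfun (1 / 2) ξ =
      (((16 * Real.sqrt 2 / 15) * (1 - (5 / 16) * ξ ^ 2) : ℝ) : ℂ)) ∧
    (∀ ξ : ℝ, Yfun (2 / 3) ξ =
      (((32 * Real.sqrt 3 / 35) * (1 - (7 / 24) * ξ ^ 2) : ℝ) : ℂ)) ∧
    (∀ ξ : ℝ, 0 ≤ 1 - (5 / 16) * ξ ^ 2 →
      Yfun (1 / 2) ξ = (((16 * Real.sqrt 2 / 15) * qExpR 0 (-(5 / 16) * ξ ^ 2) : ℝ) : ℂ)) ∧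
    (∀ ξ : ℝ, 0 ≤ 1 - (7 / 24) * ξ ^ 2 →
      Yfun (2 / 3) ξ = (((32 * Real.sqrt 3 / 35) * qExpR 0 (-(7 / 24) * ξ ^ 2) : ℝ) : ℂ)) := by
  refine ⟨Yfun_eq_qFourier (by norm_num), Yfun_eq_qFourier (by norm_num), Yfun_one_half,
    Yfun_two_thirds, fun ξ hξ => ?_, fun ξ hξ => ?_⟩
  · rw [Yfun_one_half, qExpR_zero_of_nonneg (by linarith), neg_mul, ← sub_eq_add_neg]
  · rw [Yfun_two_thirds, qExpR_zero_of_nonneg (by linarith), neg_mul, ← sub_eq_add_neg]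

end
end

section
/- Let 1 < q < 3 and β > 0. Set a = −1/(3−q), q₁ = (1+q)/(3−q), B = (2−q)/(4 β^{2−q} C_q^{2(q−1)}), and let U(t,x) := t^a · G_q(β; t^a x) for t > 0, x ∈ ℝ (the self-similar profile associated with the porous medium equation u_t = (u^{1−q} u_x)_x). Then its q-Fourier transform Û(t,ξ) := F_q[U(t,·)](ξ) is, for each fixed ξ ∈ ℝ, a positive differentiable function of t on (0,∞) satisfying the nonlinear ordinary differential equation ∂_t Û(t,ξ) = −B · ξ² · t^{−(q−1)/(3−q)} · Û(t,ξ)^{q₁}. -/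
open MeasureTheory Complex Real Set Filter

noncomputable section

/-- The normalizing constant `C_q = ∫_ℝ e_q^{-x²} dx`. -/
def Cq (q : ℝ) : ℝ := ∫ x : ℝ, qExpR q (-x ^ 2)

/-- The `q`-Gaussian `G_q(β; x) = (√β / C_q) e_q^{-β x²}`. -/
def qGaussian (q β x : ℝ) : ℝ := (Real.sqrt β / Cq q) * qExpR q (-β * x ^ 2)

/-- A positive real factor can be pulled out of a complex power. -/
lemma cpow_ofReal_mul_of_pos {p : ℝ} (hp : 0 < p) {w : ℂ} (hw : w ≠ 0) (s : ℂ) :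
    ((p : ℂ) * w) ^ s = (p : ℂ) ^ s * w ^ s := by
  have hp0 : (p : ℂ) ≠ 0 := ofReal_ne_zero.mpr hp.ne'
  rw [cpow_def_of_ne_zero (mul_ne_zero hp0 hw), cpow_def_of_ne_zero hp0, cpow_def_of_ne_zero hw,
    log_ofReal_mul hp hw, ← Complex.exp_add, ofReal_log hp.le]
  ring_nf

lemma integrable_mul_one_add_sq_rpow_neg {m r : ℝ} (hm : 0 < m) (hr : 1 / 2 < r) :
    Integrable (fun x : ℝ => (m * (1 + x ^ 2)) ^ (-r)) := by
  have h := (integrable_rpow_neg_one_add_norm_sq (E := ℝ) (μ := volume) (r := 2 * r)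
    (by simp; linarith)).const_mul (m ^ (-r))
  refine h.congr (Eventually.of_forall fun x => ?_)
  simp only
  rw [Real.mul_rpow hm.le (by positivity), Real.norm_eq_abs, sq_abs]
  congr 2
  ring

lemma tendsto_mul_one_add_sq_rpow_neg {m r : ℝ} (hm : 0 < m) (hr : 0 < r) :
    Tendsto (fun x : ℝ => (m * (1 + x ^ 2)) ^ (-r)) atTop (nhds 0) := by
  refine (tendsto_rpow_neg_atTop hr).comp (Tendsto.const_mul_atTop hm ?_)
  exact tendsto_atTop_add_const_left _ _ (tendsto_pow_atTop two_ne_zero)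

/-- In the strip `c v² ≤ D - m`, the quadratic `D + c z²` has real part at least
`m (1 + x²)`. -/
lemma le_re_add_mul_sq {D c m x v : ℝ} (hc : m ≤ c) (hv : m ≤ D - c * v ^ 2) :
    m * (1 + x ^ 2) ≤ ((D : ℂ) + c * ((x : ℂ) + v * I) ^ 2).re := by
  have h : ((D : ℂ) + c * ((x : ℂ) + v * I) ^ 2).re = D + c * (x ^ 2 - v ^ 2) := by
    simp [pow_two]
  rw [h]
  nlinarith [mul_le_mul_of_nonneg_right hc (sq_nonneg x)]

lemma norm_cpow_add_mul_sq_le {D c m x v r : ℝ} (hm : 0 < m) (hr : 0 < r) (hc : m ≤ c)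
    (hv : m ≤ D - c * v ^ 2) :
    ‖((D : ℂ) + c * ((x : ℂ) + v * I) ^ 2) ^ ((-r : ℝ) : ℂ)‖ ≤ (m * (1 + x ^ 2)) ^ (-r) := by
  rw [norm_cpow_real]
  exact Real.rpow_le_rpow_of_nonpos (by positivity)
    ((le_re_add_mul_sq hc hv).trans (re_le_norm _)) (by linarith)

lemma add_mul_sq_mem_slitPlane {D c m x v : ℝ} (hm : 0 < m) (hc : m ≤ c)
    (hv : m ≤ D - c * v ^ 2) : (D : ℂ) + c * ((x : ℂ) + v * I) ^ 2 ∈ slitPlane :=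
  Or.inl ((by positivity : 0 < m * (1 + x ^ 2)).trans_le (le_re_add_mul_sq hc hv))

lemma integrable_cpow_add_mul_sq {D c m v r : ℝ} (hm : 0 < m) (hr : 1 / 2 < r) (hc : m ≤ c)
    (hv : m ≤ D - c * v ^ 2) :
    Integrable (fun x : ℝ => ((D : ℂ) + c * ((x : ℂ) + v * I) ^ 2) ^ ((-r : ℝ) : ℂ)) := by
  refine (integrable_mul_one_add_sq_rpow_neg hm hr).mono' ?_
    (Eventually.of_forall fun x => norm_cpow_add_mul_sq_le hm (by linarith) hc hv)
  refine Continuous.aestronglyMeasurable ?_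
  exact Continuous.cpow (by fun_prop) continuous_const
    fun x => add_mul_sq_mem_slitPlane hm hc hv

/-- Contour shift for powers of a quadratic: the integral of `(D + c z²)^{-r}` along a horizontal
line in the strip where the real part of `D + c z²` is positive does not depend on the line. -/
theorem integral_cpow_add_mul_sq_shift {D c y r : ℝ} (hc : 0 < c) (hr : 1 / 2 < r)
    (hy : c * y ^ 2 < D) :
    ∫ x : ℝ, ((D : ℂ) + c * ((x : ℂ) + y * I) ^ 2) ^ ((-r : ℝ) : ℂ) =
      ∫ x : ℝ, ((D : ℂ) + c * (x : ℂ) ^ 2) ^ ((-r : ℝ) : ℂ) := by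
  have hr0 : 0 < r := by linarith
  obtain ⟨m, hm, hmc, hmy⟩ : ∃ m : ℝ, 0 < m ∧ m ≤ c ∧ m ≤ D - c * y ^ 2 :=
    ⟨min c (D - c * y ^ 2), lt_min hc (by linarith), min_le_left _ _, min_le_right _ _⟩
  have hstrip : ∀ v ∈ uIcc 0 y, m ≤ D - c * v ^ 2 := by
    intro v hv
    have hvy : v ^ 2 ≤ y ^ 2 := by
      rw [sq_le_sq]
      simpa using abs_sub_left_of_mem_uIcc hv
    nlinarith
  let F : ℂ → ℂ := fun z => ((D : ℂ) + c * z ^ 2) ^ ((-r : ℝ) : ℂ)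
  have hrect : ∀ T : ℝ, (∫ x in (-T)..T, F (x + (0 : ℝ) * I)) - (∫ x in (-T)..T, F (x + y * I)) +
      I • (∫ v in (0 : ℝ)..y, F (T + v * I)) -
      I • (∫ v in (0 : ℝ)..y, F ((-T : ℝ) + v * I)) = 0 := by
    intro T
    have h := Complex.integral_boundary_rect_eq_zero_of_differentiableOn F
      ⟨-T, 0⟩ ⟨T, y⟩ ?_
    · exact h
    · intro z hz
      have hmem : (D : ℂ) + c * z ^ 2 ∈ slitPlane := by
        have := add_mul_sq_mem_slitPlane (x := z.re) hm hmc (hstrip z.im hz.2)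
        rwa [re_add_im] at this
      refine DifferentiableAt.differentiableWithinAt ?_
      exact DifferentiableAt.cpow (by fun_prop) (by fun_prop) hmem
  have hside : ∀ T : ℝ → ℝ, (∀ x, T x ^ 2 = x ^ 2) →
      Tendsto (fun x : ℝ => I • ∫ v in (0 : ℝ)..y, F (T x + v * I)) atTop (nhds 0) := by
    intro T hT
    suffices h : Tendsto (fun x : ℝ => ∫ v in (0 : ℝ)..y, F (T x + v * I)) atTop (nhds 0) by
      simpa using h.const_smul I
    refine squeeze_zero_norm (a := fun x : ℝ => (m * (1 + x ^ 2)) ^ (-r) * |y - 0|) ?_ ?_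
    · intro x
      refine intervalIntegral.norm_integral_le_of_norm_le_const fun v hv => ?_
      rw [← hT x]
      exact norm_cpow_add_mul_sq_le hm hr0 hmc (hstrip v (uIoc_subset_uIcc hv))
    · simpa using (tendsto_mul_one_add_sq_rpow_neg hm hr0).mul_const |y - 0|
  have hline : ∀ v : ℝ, m ≤ D - c * v ^ 2 → Tendsto (fun T : ℝ => ∫ x in (-T)..T, F (x + v * I))
      atTop (nhds (∫ x : ℝ, F (x + v * I))) := fun v hv =>
    intervalIntegral_tendsto_integral (integrable_cpow_add_mul_sq hm hr hmc hv)
      tendsto_neg_atTop_atBot tendsto_id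
  have hlim := (((hline 0 (hstrip 0 left_mem_uIcc)).sub (hline y hmy)).add
    (hside id fun _ => rfl)).sub (hside Neg.neg fun x => neg_sq x)
  simp only [id, hrect, add_zero, sub_zero] at hlim
  have h0 := tendsto_nhds_unique hlim tendsto_const_nhds
  have h1 := sub_eq_zero.mp h0
  simpa [F] using h1.symm

lemma qExpR_neg_mul_sq {q b : ℝ} (hq : 1 < q) (hb : 0 ≤ b) (x : ℝ) :
    qExpR q (-b * x ^ 2) = (1 + (q - 1) * b * x ^ 2) ^ (-(1 / (q - 1))) := by
  have h : 1 + (1 - q) * (-b * x ^ 2) = 1 + (q - 1) * b * x ^ 2 := by ring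
  have hpos : 0 < 1 + (q - 1) * b * x ^ 2 := by
    have : 0 < q - 1 := by linarith
    positivity
  rw [qExpR, if_neg hq.ne', h, if_neg hpos.not_ge, ← neg_sub q 1, div_neg]

lemma Cq_eq_integral {q : ℝ} (hq : 1 < q) :
    Cq q = ∫ x : ℝ, (1 + (q - 1) * x ^ 2) ^ (-(1 / (q - 1))) := by
  refine integral_congr_ae (Eventually.of_forall fun x => ?_)
  simpa using qExpR_neg_mul_sq hq zero_le_one x

lemma one_half_lt_one_div_sub_one {q : ℝ} (hq1 : 1 < q) (hq3 : q < 3) : 1 / 2 < 1 / (q - 1) :=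
  one_div_lt_one_div_of_lt (by linarith) (by linarith)

lemma Cq_pos {q : ℝ} (hq1 : 1 < q) (hq3 : q < 3) : 0 < Cq q := by
  have hq : 0 < q - 1 := by linarith
  have hr := one_half_lt_one_div_sub_one hq1 hq3
  have hpos : ∀ x : ℝ, 0 < (1 + (q - 1) * x ^ 2) ^ (-(1 / (q - 1))) := fun x =>
    Real.rpow_pos_of_pos (by positivity) _
  have hm : 0 < min 1 (q - 1) := lt_min one_pos hq
  have hcont : Continuous fun x : ℝ => (1 + (q - 1) * x ^ 2) ^ (-(1 / (q - 1))) :=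
    Continuous.rpow_const (by fun_prop) fun x => Or.inl (by positivity)
  have hint : Integrable fun x : ℝ => (1 + (q - 1) * x ^ 2) ^ (-(1 / (q - 1))) := by
    refine (integrable_mul_one_add_sq_rpow_neg hm hr).mono' hcont.aestronglyMeasurable
      (Eventually.of_forall fun x => ?_)
    rw [Real.norm_of_nonneg (hpos x).le]
    refine Real.rpow_le_rpow_of_nonpos (by positivity) ?_ (by linarith)
    nlinarith [min_le_left 1 (q - 1),
      mul_le_mul_of_nonneg_right (min_le_right 1 (q - 1)) (sq_nonneg x)]
  rw [Cq_eq_integral hq1]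
  exact integral_pos_of_integrable_nonneg_nonzero hcont hint (fun x => (hpos x).le) (hpos 0).ne'

lemma integral_add_mul_sq_rpow {q b D : ℝ} (hq : 1 < q) (hb : 0 < b) (hD : 0 < D) :
    ∫ x : ℝ, (D + (q - 1) * b * x ^ 2) ^ (-(1 / (q - 1))) =
      D ^ (1 / 2 - 1 / (q - 1)) * (Cq q / √b) := by
  have hq0 : 0 < q - 1 := by linarith
  have h : ∀ x : ℝ, (D + (q - 1) * b * x ^ 2) ^ (-(1 / (q - 1))) =
      D ^ (-(1 / (q - 1))) * (1 + (q - 1) * (√(b / D) * x) ^ 2) ^ (-(1 / (q - 1))) := by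
    intro x
    rw [← Real.mul_rpow hD.le (by positivity), mul_pow, Real.sq_sqrt (by positivity)]
    congr 1
    field_simp
  simp_rw [h]
  rw [integral_const_mul, Measure.integral_comp_mul_left
    (fun x : ℝ => (1 + (q - 1) * x ^ 2) ^ (-(1 / (q - 1)))), ← Cq_eq_integral hq,
    abs_of_nonneg (by positivity), Real.sqrt_div hb.le, sub_eq_add_neg (1 / 2), Real.rpow_add hD,
    ← Real.sqrt_eq_rpow, smul_eq_mul, inv_div]
  ring

/-- The `q`-exponential factor of the `q`-Fourier transform merges with a `q`-Gaussian profile into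
a power of a single quadratic polynomial, here with its square completed. -/
lemma qGaussian_profile_mul_qExp {q A b : ℝ} (hq : 1 < q) (hA : 0 < A) (hb : 0 < b) (ξ x : ℝ)
    {y : ℝ} (hy : y = -(ξ * A ^ (q - 1) / (2 * b))) :
    ((A * qExpR q (-b * x ^ 2) : ℝ) : ℂ) *
        qExp q (I * (x : ℂ) * (ξ : ℂ) * (((A * qExpR q (-b * x ^ 2)) ^ (q - 1) : ℝ) : ℂ)) =
      A * (((1 + (q - 1) * b * y ^ 2 : ℝ) : ℂ) + ((q - 1) * b : ℝ) * ((x : ℂ) + y * I) ^ 2) ^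
        ((-(1 / (q - 1)) : ℝ) : ℂ) := by
  have hq0 : 0 < q - 1 := by linarith
  have hP : 0 < 1 + (q - 1) * b * x ^ 2 := by positivity
  rw [qExpR_neg_mul_sq hq hb.le]
  set P := 1 + (q - 1) * b * x ^ 2 with hPdef
  have hpow : (A * P ^ (-(1 / (q - 1)))) ^ (q - 1) = A ^ (q - 1) * P⁻¹ := by
    rw [Real.mul_rpow hA.le (by positivity), ← Real.rpow_mul hP.le,
      show -(1 / (q - 1)) * (q - 1) = -1 by field_simp, Real.rpow_neg_one]
  rw [hpow]
  set w : ℂ := 1 + (1 - q) * (I * (x : ℂ) * (ξ : ℂ) * ((A ^ (q - 1) * P⁻¹ : ℝ) : ℂ)) with hw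
  have hwre : w.re = 1 := by
    have : w = 1 + (((1 - q) * x * ξ * (A ^ (q - 1) * P⁻¹) : ℝ) : ℂ) * I := by
      rw [hw]; push_cast; ring
    rw [this, add_re, re_ofReal_mul]
    simp
  have hw0 : w ≠ 0 := fun h => by simp [h] at hwre
  have hexp : (1 : ℂ) / (1 - q) = ((-(1 / (q - 1)) : ℝ) : ℂ) := by
    push_cast
    rw [← div_neg, neg_sub]
  have hprod : (P : ℂ) * w =
      ((1 + (q - 1) * b * y ^ 2 : ℝ) : ℂ) + ((q - 1) * b : ℝ) * ((x : ℂ) + y * I) ^ 2 := by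
    have hPc : (P : ℂ) ≠ 0 := ofReal_ne_zero.mpr hP.ne'
    have h1 : (P : ℂ) * w = P + (1 - q) * (I * x * ξ * ((A ^ (q - 1) : ℝ) : ℂ)) := by
      rw [hw, ofReal_mul, ofReal_inv]
      field_simp
    have h2 : ξ * A ^ (q - 1) = -(2 * b * y) := by rw [hy]; field_simp
    have h3 : (ξ : ℂ) * ((A ^ (q - 1) : ℝ) : ℂ) = -(2 * b * y) := by exact_mod_cast h2
    rw [h1, mul_assoc (I * (x : ℂ)), h3, hPdef]
    push_cast
    linear_combination (-(q - 1) * b * y ^ 2 : ℂ) * I_sq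
  rw [qExp, if_neg hq.ne', if_neg (by rw [← hw, hwre]; simp), ← hw, hexp, ← hprod,
    cpow_ofReal_mul_of_pos hP hw0, ofReal_mul, ofReal_cpow hP.le]
  ring

/-- The `q`-Fourier transform of `A e_q^{-b x²}`. -/
theorem qFourier_qGaussian_profile {q A b : ℝ} (hq1 : 1 < q) (hq3 : q < 3) (hA : 0 < A)
    (hb : 0 < b) (ξ : ℝ) :
    qFourier q (fun x => A * qExpR q (-b * x ^ 2)) ξ =
      ((A * ((1 + (q - 1) * ξ ^ 2 * (A ^ (q - 1)) ^ 2 / (4 * b)) ^ (1 / 2 - 1 / (q - 1)) *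
        (Cq q / √b)) : ℝ) : ℂ) := by
  have hq0 : 0 < q - 1 := by linarith
  obtain ⟨y, hy⟩ : ∃ y : ℝ, y = -(ξ * A ^ (q - 1) / (2 * b)) := ⟨_, rfl⟩
  have hD : 1 + (q - 1) * ξ ^ 2 * (A ^ (q - 1)) ^ 2 / (4 * b) = 1 + (q - 1) * b * y ^ 2 := by
    rw [hy]
    field_simp
    ring
  have hset : {x : ℝ | 0 < A * qExpR q (-b * x ^ 2)} = univ := by
    refine eq_univ_of_forall fun x => ?_
    rw [mem_ofPred_eq, qExpR_neg_mul_sq hq1 hb.le]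
    positivity
  rw [qFourier, hset, Measure.restrict_univ, hD]
  simp_rw [qGaussian_profile_mul_qExp hq1 hA hb ξ _ hy]
  rw [integral_const_mul, integral_cpow_add_mul_sq_shift (by positivity)
    (one_half_lt_one_div_sub_one hq1 hq3) (by linarith),
    ← integral_add_mul_sq_rpow hq1 hb (by positivity), ofReal_mul A, ← integral_complex_ofReal]
  congr 2
  ext x
  rw [ofReal_cpow (by positivity)]
  push_cast
  rfl

/-- for the self-similar solution `U(t,x) = t^a G_q(β; t^a x)` of the
porous medium equation, the `q`-Fourier transform `Û(t,ξ) = F_q[U(t,·)](ξ)` is, for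
each fixed `ξ`, a positive differentiable (real-valued) function of `t > 0`
satisfying `∂_t Û = -B ξ² t^{-(q-1)/(3-q)} Û^{q₁}`. -/
theorem qFourier_porous_medium (q β : ℝ) (hq1 : 1 < q) (hq3 : q < 3) (hβ : 0 < β) :
    let a : ℝ := -1 / (3 - q)
    let q₁ : ℝ := (1 + q) / (3 - q)
    let B : ℝ := (2 - q) / (4 * β ^ (2 - q) * Cq q ^ (2 * (q - 1)))
    ∀ ξ : ℝ, ∃ W : ℝ → ℝ,
      (∀ t : ℝ, 0 < t →
        qFourier q (fun x => t ^ a * qGaussian q β (t ^ a * x)) ξ = ((W t : ℝ) : ℂ)) ∧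
      (∀ t : ℝ, 0 < t → 0 < W t) ∧
      (∀ t : ℝ, 0 < t →
        HasDerivAt W (-B * ξ ^ 2 * t ^ (-(q - 1) / (3 - q)) * W t ^ q₁) t) := by
  intro a q₁ B ξ
  have hq0 : 0 < q - 1 := by linarith
  have h3q : 0 < 3 - q := by linarith
  have hC := Cq_pos hq1 hq3
  obtain ⟨K, hK⟩ : ∃ K : ℝ, K = 1 / (4 * β ^ (2 - q) * Cq q ^ (2 * (q - 1))) := ⟨_, rfl⟩
  have hKpos : 0 < K := by rw [hK]; positivity
  have hB : B = (2 - q) * K := by rw [hK]; simp only [B]; ring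
  have hDpos : ∀ t : ℝ, 0 < t → 0 < 1 + (q - 1) * ξ ^ 2 * K * t ^ (2 * (2 - q) / (3 - q)) := by
    intro t ht
    positivity
  refine ⟨fun t => (1 + (q - 1) * ξ ^ 2 * K * t ^ (2 * (2 - q) / (3 - q))) ^
    (1 / 2 - 1 / (q - 1)), fun t ht => ?_, fun t ht => Real.rpow_pos_of_pos (hDpos t ht) _,
    fun t ht => ?_⟩
  · have hs : 0 < t ^ a := Real.rpow_pos_of_pos ht a
    have hf : (fun x => t ^ a * qGaussian q β (t ^ a * x)) =
        fun x => t ^ a * (√β / Cq q) * qExpR q (-(β * (t ^ a) ^ 2) * x ^ 2) := by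
      ext x
      rw [qGaussian, ← mul_assoc]
      congr 2
      ring
    rw [hf, qFourier_qGaussian_profile hq1 hq3 (by positivity) (by positivity), ofReal_inj,
      Real.sqrt_mul hβ.le, Real.sqrt_sq hs.le]
    have hD : (q - 1) * ξ ^ 2 * ((t ^ a * (√β / Cq q)) ^ (q - 1)) ^ 2 / (4 * (β * (t ^ a) ^ 2)) =
        (q - 1) * ξ ^ 2 * K * t ^ (2 * (2 - q) / (3 - q)) := by
      have h1 : ((t ^ a * (√β / Cq q)) ^ (q - 1)) ^ 2 =
          t ^ (2 * a * (q - 1)) * (β ^ (q - 1) / Cq q ^ (2 * (q - 1))) := by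
        rw [Real.rpow_pow_comm (by positivity), mul_pow, div_pow, Real.sq_sqrt hβ.le,
          Real.mul_rpow (by positivity) (by positivity), Real.div_rpow hβ.le (by positivity),
          Real.rpow_mul hC.le, Real.rpow_two, ← Real.rpow_natCast (t ^ a), ← Real.rpow_mul ht.le,
          ← Real.rpow_mul ht.le]
        congr 2
        push_cast
        ring
      have h2 : t ^ (2 * a * (q - 1)) = t ^ (2 * (2 - q) / (3 - q)) * (t ^ a) ^ 2 := by
        rw [← Real.rpow_natCast (t ^ a), ← Real.rpow_mul ht.le, ← Real.rpow_add ht]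
        congr 1
        simp only [a]
        field_simp
        push_cast
        ring
      have h3 : β = β ^ (q - 1) * β ^ (2 - q) := by
        rw [← Real.rpow_add hβ]
        norm_num
      rw [h1, h2, hK]
      have hβ1 : β ^ (q - 1) ≠ 0 := (Real.rpow_pos_of_pos hβ _).ne'
      nth_rw 2 [h3]
      field_simp
    rw [hD]
    field_simp
  · have hD := hDpos t ht
    have h := (((Real.hasDerivAt_rpow_const (p := 2 * (2 - q) / (3 - q))
      (Or.inl ht.ne')).const_mul ((q - 1) * ξ ^ 2 * K)).const_add 1).rpow_const
      (p := 1 / 2 - 1 / (q - 1)) (Or.inl hD.ne')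
    refine h.congr_deriv ?_
    rw [← Real.rpow_mul hD.le, hB,
      show 2 * (2 - q) / (3 - q) - 1 = -(q - 1) / (3 - q) by field_simp; ring,
      show (1 / 2 - 1 / (q - 1)) * q₁ = 1 / 2 - 1 / (q - 1) - 1 by simp only [q₁]; field_simp; ring]
    field_simp
    ring

end
end
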